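/- (Proposition 1, MDI as an R² value.) Let S^{(k)} = {s_1, …, s_m} be a nonempty finite family of splits satisfying the tree (laminar) condition (the splits of a fitted tree that threshold feature X_k), and suppose the responses are not all equal, i.e., Σ_{i=1}^{n} (y_i − ȳ)² > 0 where ȳ = n⁻¹ Σ_{i=1}^{n} y_i. Define the fitted values of the OLS regression of y on the stump features of S^{(k)}: ŷ^{(k)}_i = ȳ + Σ_{j=1}^{m} β_j ψ(i; s_j) with β_j = (Σ_{i=1}^{n} y_i ψ(i; s_j)) / |v_j|, and define MDI_k = n⁻¹ Σ_{j=1}^{m} |v_j| · Δ̂(s_j) and R²(y, ŷ^{(k)}) = 1 − Σ_{i=1}^{n}(y_i − ŷ^{(k)}_i)² / Σ_{i=1}^{n}(y_i − ȳ)². Then MDI_k = R²(y, ŷ^{(k)}) · (n⁻¹ Σ_{i=1}^{n}(y_i − ȳ)²); in particular MDI_k is proportional to R²(y, ŷ^{(k)}) with proportionality constant equal to the empirical variance of y. -/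

import Mathlib

open Finset

variable {n : ℕ}

/-- Mean response of the training samples in node `v`. -/
noncomputable def nodeMean (y : Fin n → ℝ) (v : Finset (Fin n)) : ℝ :=
  ((v.card : ℝ))⁻¹ * ∑ i ∈ v, y i

/-- Stump function of the split of a node into children `vL`, `vR`. -/
noncomputable def stump (vL vR : Finset (Fin n)) (i : Fin n) : ℝ :=
  ((vR.card : ℝ) * (if i ∈ vL then (1 : ℝ) else 0)
      - (vL.card : ℝ) * (if i ∈ vR then (1 : ℝ) else 0))
    / Real.sqrt ((vL.card : ℝ) * (vR.card : ℝ))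

/-- Impurity decrease of the split of node `vL ∪ vR` into children `vL`, `vR`. -/
noncomputable def impurityDecrease (y : Fin n → ℝ) (vL vR : Finset (Fin n)) : ℝ :=
  (((vL ∪ vR).card : ℝ))⁻¹ *
    ((∑ i ∈ vL ∪ vR, (y i - nodeMean y (vL ∪ vR)) ^ 2)
      - (∑ i ∈ vL, (y i - nodeMean y vL) ^ 2)
      - (∑ i ∈ vR, (y i - nodeMean y vR) ^ 2))

theorem sum_mul_stump (f : Fin n → ℝ) (vL vR : Finset (Fin n)) :
    ∑ i, f i * stump vL vR i
      = ((vR.card : ℝ) * ∑ i ∈ vL, f i - (vL.card : ℝ) * ∑ i ∈ vR, f i)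
        / Real.sqrt ((vL.card : ℝ) * (vR.card : ℝ)) := by
  have h (v : Finset (Fin n)) : ∑ i ∈ v, f i = ∑ i, f i * (if i ∈ v then (1 : ℝ) else 0) := by
    simp
  rw [h vL, h vR, mul_sum, mul_sum, ← sum_sub_distrib, sum_div]
  refine sum_congr rfl fun i _ => ?_
  unfold stump
  ring

theorem sum_mul_stump_of_const {f : Fin n → ℝ} {vL vR : Finset (Fin n)} {c : ℝ}
    (hf : ∀ i ∈ vL ∪ vR, f i = c) : ∑ i, f i * stump vL vR i = 0 := by
  have hfL : ∑ i ∈ vL, f i = vL.card * c := by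
    rw [sum_congr rfl fun i hi => hf i (mem_union_left _ hi)]; simp
  have hfR : ∑ i ∈ vR, f i = vR.card * c := by
    rw [sum_congr rfl fun i hi => hf i (mem_union_right _ hi)]; simp
  rw [sum_mul_stump, hfL, hfR]
  ring

theorem stump_of_mem_left {vL vR : Finset (Fin n)} (hd : Disjoint vL vR) {i : Fin n}
    (hi : i ∈ vL) : stump vL vR i = vR.card / Real.sqrt ((vL.card : ℝ) * (vR.card : ℝ)) := by
  simp [stump, hi, disjoint_left.mp hd hi]

theorem stump_of_mem_right {vL vR : Finset (Fin n)} (hd : Disjoint vL vR) {i : Fin n}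
    (hi : i ∈ vR) : stump vL vR i = -vL.card / Real.sqrt ((vL.card : ℝ) * (vR.card : ℝ)) := by
  simp [stump, hi, disjoint_right.mp hd hi]

theorem stump_of_notMem {vL vR : Finset (Fin n)} {i : Fin n} (hi : i ∉ vL ∪ vR) :
    stump vL vR i = 0 := by
  simp only [mem_union, not_or] at hi
  simp [stump, hi.1, hi.2]

theorem sum_stump_mul_self {vL vR : Finset (Fin n)} (hL : vL.Nonempty) (hR : vR.Nonempty)
    (hd : Disjoint vL vR) :
    ∑ i, stump vL vR i * stump vL vR i = ((vL ∪ vR).card : ℝ) := by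
  have hLpos : (0 : ℝ) < vL.card := by exact_mod_cast hL.card_pos
  have hRpos : (0 : ℝ) < vR.card := by exact_mod_cast hR.card_pos
  rw [sum_mul_stump, sum_congr rfl fun i hi => stump_of_mem_left hd hi,
    sum_congr rfl fun i hi => stump_of_mem_right hd hi, card_union_of_disjoint hd]
  have hpos : 0 < Real.sqrt ((vL.card : ℝ) * vR.card) := Real.sqrt_pos.mpr (by positivity)
  simp only [sum_const, nsmul_eq_mul, Nat.cast_add]
  field_simp
  rw [Real.sq_sqrt (by positivity)]
  ring

theorem sum_stump_mul_stump {vL vR wL wR : Finset (Fin n)} (hdv : Disjoint vL vR)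
    (hdw : Disjoint wL wR)
    (laminar : Disjoint (vL ∪ vR) (wL ∪ wR)
      ∨ (vL ∪ vR) ⊆ wL ∨ (vL ∪ vR) ⊆ wR ∨ (wL ∪ wR) ⊆ vL ∨ (wL ∪ wR) ⊆ vR) :
    ∑ i, stump vL vR i * stump wL wR i = 0 := by
  rcases laminar with h | h | h | h | h
  · exact sum_mul_stump_of_const fun i hi => stump_of_notMem (disjoint_right.mp h hi)
  · simp_rw [mul_comm (stump vL vR _)]
    exact sum_mul_stump_of_const fun i hi => stump_of_mem_left hdw (h hi)
  · simp_rw [mul_comm (stump vL vR _)]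
    exact sum_mul_stump_of_const fun i hi => stump_of_mem_right hdw (h hi)
  · exact sum_mul_stump_of_const fun i hi => stump_of_mem_left hdv (h hi)
  · exact sum_mul_stump_of_const fun i hi => stump_of_mem_right hdv (h hi)

theorem sum_sub_nodeMean_sq (y : Fin n → ℝ) {v : Finset (Fin n)} (hv : v.Nonempty) :
    ∑ i ∈ v, (y i - nodeMean y v) ^ 2 = ∑ i ∈ v, y i ^ 2 - (∑ i ∈ v, y i) ^ 2 / v.card := by
  have hpos : (0 : ℝ) < v.card := by exact_mod_cast hv.card_pos
  simp only [sub_sq, sum_add_distrib, sum_sub_distrib, ← sum_mul, ← mul_sum, sum_const,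
    nsmul_eq_mul, nodeMean]
  field_simp
  ring

theorem card_mul_impurityDecrease (y : Fin n → ℝ) {vL vR : Finset (Fin n)}
    (hL : vL.Nonempty) (hR : vR.Nonempty) (hd : Disjoint vL vR) :
    ((vL ∪ vR).card : ℝ) * impurityDecrease y vL vR
      = (∑ i, y i * stump vL vR i) ^ 2 / ((vL ∪ vR).card : ℝ) := by
  have hLpos : (0 : ℝ) < vL.card := by exact_mod_cast hL.card_pos
  have hRpos : (0 : ℝ) < vR.card := by exact_mod_cast hR.card_pos
  rw [impurityDecrease, sum_sub_nodeMean_sq y hL, sum_sub_nodeMean_sq y hR,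
    sum_sub_nodeMean_sq y (hL.mono subset_union_left), sum_mul_stump, div_pow,
    Real.sq_sqrt (mul_pos hLpos hRpos).le, sum_union hd, sum_union hd,
    card_union_of_disjoint hd, Nat.cast_add]
  field_simp
  ring

/-- Pythagoras for the projection onto a finite orthogonal family. -/
theorem sum_sub_sum_mul_sq_of_orthogonal {ι κ : Type*} [Fintype ι] [Fintype κ]
    (f : ι → ℝ) (ψ : κ → ι → ℝ) (β w : κ → ℝ)
    (horth : ∀ j j', j ≠ j' → ∑ i, ψ j i * ψ j' i = 0)
    (hself : ∀ j, ∑ i, ψ j i * ψ j i = w j)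
    (hcoef : ∀ j, ∑ i, f i * ψ j i = β j * w j) :
    ∑ i, (f i - ∑ j, β j * ψ j i) ^ 2 = ∑ i, f i ^ 2 - ∑ j, β j ^ 2 * w j := by
  have hcross : ∑ i, f i * ∑ j, β j * ψ j i = ∑ j, β j ^ 2 * w j := by
    simp_rw [mul_sum]
    rw [sum_comm]
    refine sum_congr rfl fun j _ => ?_
    simp_rw [mul_left_comm (f _)]
    rw [← mul_sum, hcoef]
    ring
  have hproj (j : κ) : ∑ i, (∑ j', β j' * ψ j' i) * ψ j i = β j * w j := by
    simp_rw [sum_mul, mul_assoc]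
    rw [sum_comm]
    simp_rw [← mul_sum]
    rw [sum_eq_single j (fun j' _ hj => by rw [horth j' j hj, mul_zero]) (by simp), hself]
  have hnorm : ∑ i, (∑ j, β j * ψ j i) ^ 2 = ∑ j, β j ^ 2 * w j := by
    have (i : ι) : (∑ j, β j * ψ j i) ^ 2
        = ∑ j, β j * ((∑ j', β j' * ψ j' i) * ψ j i) := by
      rw [sq]
      conv_lhs => rw [mul_sum]
      exact sum_congr rfl fun j _ => by ring
    simp_rw [this]
    rw [sum_comm]
    refine sum_congr rfl fun j _ => ?_
    rw [← mul_sum, hproj]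
    ring
  simp_rw [sub_sq, mul_assoc]
  rw [sum_add_distrib, sum_sub_distrib, ← mul_sum, hcross, hnorm]
  ring

theorem mdi_eq_r_squared {m : ℕ} (hm : 0 < m) (y : Fin n → ℝ)
    (vL vR : Fin m → Finset (Fin n))
    (hL : ∀ j, (vL j).Nonempty) (hR : ∀ j, (vR j).Nonempty)
    (hd : ∀ j, Disjoint (vL j) (vR j))
    (laminar : ∀ j j', j ≠ j' →
      Disjoint (vL j ∪ vR j) (vL j' ∪ vR j')
      ∨ (vL j ∪ vR j) ⊆ vL j' ∨ (vL j ∪ vR j) ⊆ vR j'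
      ∨ (vL j' ∪ vR j') ⊆ vL j ∨ (vL j' ∪ vR j') ⊆ vR j)
    (hTSS : 0 < ∑ i, (y i - (n : ℝ)⁻¹ * ∑ i', y i') ^ 2) :
    let ybar := (n : ℝ)⁻¹ * ∑ i, y i
    let β := fun j => (∑ i, y i * stump (vL j) (vR j) i) / (((vL j ∪ vR j).card : ℝ))
    let yhat := fun i => ybar + ∑ j, β j * stump (vL j) (vR j) i
    let MDIk := (n : ℝ)⁻¹ * ∑ j, ((vL j ∪ vR j).card : ℝ) * impurityDecrease y (vL j) (vR j)
    let R2 := 1 - (∑ i, (y i - yhat i) ^ 2) / (∑ i, (y i - ybar) ^ 2)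
    MDIk = R2 * ((n : ℝ)⁻¹ * ∑ i, (y i - ybar) ^ 2) := by
  intro ybar β yhat MDIk R2
  have hcard (j : Fin m) : ((vL j ∪ vR j).card : ℝ) ≠ 0 := by
    exact_mod_cast ((hL j).mono subset_union_left).card_pos.ne'
  have hRSS : ∑ i, (y i - yhat i) ^ 2
      = ∑ i, (y i - ybar) ^ 2 - ∑ j, β j ^ 2 * ((vL j ∪ vR j).card : ℝ) := by
    rw [← sum_sub_sum_mul_sq_of_orthogonal (fun i => y i - ybar)
      (fun j => stump (vL j) (vR j)) β (fun j => ((vL j ∪ vR j).card : ℝ))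
      (fun j j' h => sum_stump_mul_stump (hd j) (hd j') (laminar j j' h))
      (fun j => sum_stump_mul_self (hL j) (hR j) (hd j))]
    · exact sum_congr rfl fun i _ => by simp only [yhat]; ring
    · intro j
      simp_rw [sub_mul]
      rw [sum_sub_distrib, sum_mul_stump_of_const (f := fun _ => ybar) (fun _ _ => rfl), sub_zero]
      exact (div_mul_cancel₀ _ (hcard j)).symm
  have hMDI : MDIk = (n : ℝ)⁻¹ * ∑ j, β j ^ 2 * ((vL j ∪ vR j).card : ℝ) := by
    simp only [MDIk]
    congr 1
    refine sum_congr rfl fun j _ => ?_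
    rw [card_mul_impurityDecrease y (hL j) (hR j) (hd j)]
    simp only [β]
    have := hcard j
    field_simp
  have hT : ∑ i, (y i - ybar) ^ 2 ≠ 0 := hTSS.ne'
  simp only [R2]
  rw [hMDI, hRSS]
  field_simp
  ring
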